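/- arXiv:math/0501553 — 5 statements merged into one kernel-verified Lean document; each statement's English description precedes it below -/
import Mathlib

section
/- For every ν ∈ ℝ and every positive definite real symmetric 3×3 matrix x, one has K_ν^{[3]}(x) = (det x)^{−ν} · K_{−ν}^{[3]}(x). -/
open MeasureTheory Real Matrix

noncomputable def poch (a : ℝ) (k : ℕ) : ℝ := ∏ i ∈ Finset.range k, (a + i)

def sym3 (a b : Fin 3 → ℝ) : Matrix (Fin 3) (Fin 3) ℝ :=
  !![a 0, b 0, b 1;
     b 0, a 1, b 2;
     b 1, b 2, a 2]

noncomputable def K3 (ν : ℝ) (x : Matrix (Fin 3) (Fin 3) ℝ) : ℝ :=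
  (Real.sqrt 2) ^ 3 *
    ∫ p in {p : (Fin 3 → ℝ) × (Fin 3 → ℝ) | (sym3 p.1 p.2).PosDef},
      Real.exp (-(sym3 p.1 p.2)⁻¹.trace - (x * sym3 p.1 p.2).trace) *
        (sym3 p.1 p.2).det ^ (ν - 2)

def sym2 (a : Fin 2 → ℝ) (b : ℝ) : Matrix (Fin 2) (Fin 2) ℝ := !![a 0, b; b, a 1]

noncomputable def K2 (μ : ℝ) (x : Matrix (Fin 2) (Fin 2) ℝ) : ℝ :=
  Real.sqrt 2 *
    ∫ p in {p : (Fin 2 → ℝ) × ℝ | (sym2 p.1 p.2).PosDef},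
      Real.exp (-(sym2 p.1 p.2)⁻¹.trace - (x * sym2 p.1 p.2).trace) *
        (sym2 p.1 p.2).det ^ (μ - 3/2)

noncomputable def J31 (d ν t₁ t₂ t₃ : ℝ) : ℝ :=
  ∑' m : ℕ × ℕ × ℕ,
    ((-1 : ℝ) ^ (m.1 + m.2.2) * poch (1 + 2*ν + d) (m.1 + 2*m.2.1 + 4*m.2.2)
        * t₁ ^ m.1 * t₂ ^ m.2.1 * t₃ ^ m.2.2) /
      (poch 1 m.1 * poch 1 m.2.1 * poch 1 m.2.2 * poch (1 + ν) m.2.2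
        * poch (1 + ν + d/2) (m.2.1 + 2*m.2.2)
        * poch (1 + ν + d) (m.1 + 2*m.2.1 + 3*m.2.2)
        * poch (1 + 2*ν + d) (m.1 + 2*m.2.1 + 3*m.2.2))

noncomputable def J32 (d ν t₁ t₂ t₃ : ℝ) : ℝ :=
  ∑' m : ℕ × ℕ × ℕ,
    ((-1 : ℝ) ^ (m.1 + m.2.2) * poch (1 + ν) (m.1 + 2*m.2.1 + 4*m.2.2)
        * t₁ ^ ((m.1 : ℝ) - ν - d) * t₂ ^ m.2.1 * t₃ ^ m.2.2) /
      (poch (1 - ν - d) m.1 * poch 1 m.2.1 * poch 1 m.2.2 * poch (1 + ν) m.2.2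
        * poch (1 + ν + d/2) (m.2.1 + 2*m.2.2)
        * poch 1 (m.1 + 2*m.2.1 + 3*m.2.2)
        * poch (1 + ν) (m.1 + 2*m.2.1 + 3*m.2.2))

noncomputable def J33 (d ν t₁ t₂ t₃ : ℝ) : ℝ :=
  ∑' m : ℕ × ℕ × ℕ,
    ((-1 : ℝ) ^ (m.1 + m.2.2) * poch 1 (m.1 + 2*m.2.1 + 4*m.2.2)
        * t₁ ^ m.1 * t₂ ^ ((m.2.1 : ℝ) - ν - d/2) * t₃ ^ m.2.2) /
      (poch 1 m.1 * poch (1 - ν - d/2) m.2.1 * poch 1 m.2.2 * poch (1 + ν) m.2.2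
        * poch 1 (m.2.1 + 2*m.2.2)
        * poch (1 - ν) (m.1 + 2*m.2.1 + 3*m.2.2)
        * poch 1 (m.1 + 2*m.2.1 + 3*m.2.2))

noncomputable def J34 (d ν t₁ t₂ t₃ : ℝ) : ℝ :=
  ∑' m : ℕ × ℕ × ℕ,
    ((-1 : ℝ) ^ (m.1 + m.2.2) * poch (1 + ν) (m.1 + 2*m.2.1 + 4*m.2.2)
        * t₁ ^ ((m.1 : ℝ) + ν) * t₂ ^ ((m.2.1 : ℝ) - ν - d/2) * t₃ ^ m.2.2) /
      (poch (1 + ν) m.1 * poch (1 - ν - d/2) m.2.1 * poch 1 m.2.2 * poch (1 + ν) m.2.2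
        * poch 1 (m.2.1 + 2*m.2.2)
        * poch 1 (m.1 + 2*m.2.1 + 3*m.2.2)
        * poch (1 + ν) (m.1 + 2*m.2.1 + 3*m.2.2))

noncomputable def J21 (d μ t₁ t₂ : ℝ) : ℝ :=
  ∑' m : ℕ × ℕ,
    ((-1 : ℝ) ^ m.1 * t₁ ^ m.1 * t₂ ^ m.2) /
      (poch 1 m.1 * poch 1 m.2 * poch (1 + μ) m.2 * poch (1 + μ + d/2) (m.1 + 2*m.2))

noncomputable def J22 (d μ t₁ t₂ : ℝ) : ℝ :=
  ∑' m : ℕ × ℕ,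
    ((-1 : ℝ) ^ m.1 * t₁ ^ ((m.1 : ℝ) - μ - d/2) * t₂ ^ m.2) /
      (poch (1 - μ - d/2) m.1 * poch 1 m.2 * poch (1 + μ) m.2 * poch 1 (m.1 + 2*m.2))

def herm3 (a : Fin 3 → ℝ) (b : Fin 3 → ℂ) : Matrix (Fin 3) (Fin 3) ℂ :=
  !![(a 0 : ℂ), b 0, b 1;
     (starRingEnd ℂ) (b 0), (a 1 : ℂ), b 2;
     (starRingEnd ℂ) (b 1), (starRingEnd ℂ) (b 2), (a 2 : ℂ)]

/-- `sym3` as a linear map. -/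
def sym3Linear : (Fin 3 → ℝ) × (Fin 3 → ℝ) →ₗ[ℝ] Matrix (Fin 3) (Fin 3) ℝ where
  toFun p := sym3 p.1 p.2
  map_add' p q := by ext i j; fin_cases i <;> fin_cases j <;> simp [sym3]
  map_smul' c p := by ext i j; fin_cases i <;> fin_cases j <;> simp [sym3]

/-- The coordinates, with respect to `sym3`, of the upper triangle of a matrix. -/
def sym3Coords : Matrix (Fin 3) (Fin 3) ℝ →ₗ[ℝ] (Fin 3 → ℝ) × (Fin 3 → ℝ) where
  toFun M := (![M 0 0, M 1 1, M 2 2], ![M 0 1, M 0 2, M 1 2])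
  map_add' M N := by ext i <;> fin_cases i <;> simp
  map_smul' c M := by ext i <;> fin_cases i <;> simp

lemma sym3Linear_apply (p : (Fin 3 → ℝ) × (Fin 3 → ℝ)) :
    sym3Linear p = sym3 p.1 p.2 := rfl

lemma sym3Coords_sym3Linear (p : (Fin 3 → ℝ) × (Fin 3 → ℝ)) :
    sym3Coords (sym3Linear p) = p := by
  ext i <;> fin_cases i <;> rfl

lemma isSymm_sym3Linear (p : (Fin 3 → ℝ) × (Fin 3 → ℝ)) : (sym3Linear p).IsSymm := by
  ext i j; fin_cases i <;> fin_cases j <;> rfl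

lemma sym3Linear_sym3Coords {M : Matrix (Fin 3) (Fin 3) ℝ} (hM : M.IsSymm) :
    sym3Linear (sym3Coords M) = M := by
  have h := fun i j => hM.apply i j
  ext i j; fin_cases i <;> fin_cases j <;> simp [sym3Linear, sym3Coords, sym3, h]
  all_goals exact hM.apply _ _

/-- The congruence `y ↦ g y gᵀ` on symmetric matrices, in the coordinates of `sym3`. -/
def sym3Congr (g : Matrix (Fin 3) (Fin 3) ℝ) :
    (Fin 3 → ℝ) × (Fin 3 → ℝ) →ₗ[ℝ] (Fin 3 → ℝ) × (Fin 3 → ℝ) :=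
  sym3Coords ∘ₗ LinearMap.mulRight ℝ gᵀ ∘ₗ LinearMap.mulLeft ℝ g ∘ₗ sym3Linear

lemma sym3Congr_apply (g : Matrix (Fin 3) (Fin 3) ℝ) (p : (Fin 3 → ℝ) × (Fin 3 → ℝ)) :
    sym3Congr g p = sym3Coords (g * sym3Linear p * gᵀ) := rfl

lemma sym3Congr_mul (g h : Matrix (Fin 3) (Fin 3) ℝ) :
    sym3Congr (g * h) = sym3Congr g ∘ₗ sym3Congr h := by
  refine LinearMap.ext fun p => ?_
  simp only [LinearMap.comp_apply, sym3Congr_apply]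
  rw [sym3Linear_sym3Coords, transpose_mul]
  · simp only [Matrix.mul_assoc]
  · simp [IsSymm, transpose_mul, (isSymm_sym3Linear _).eq, Matrix.mul_assoc]

lemma det_sym3Congr_eq (g : Matrix (Fin 3) (Fin 3) ℝ) :
    LinearMap.det (sym3Congr g) = !![
      g 0 0 ^ 2, g 0 1 ^ 2, g 0 2 ^ 2, 2 * g 0 0 * g 0 1, 2 * g 0 0 * g 0 2, 2 * g 0 1 * g 0 2;
      g 1 0 ^ 2, g 1 1 ^ 2, g 1 2 ^ 2, 2 * g 1 0 * g 1 1, 2 * g 1 0 * g 1 2, 2 * g 1 1 * g 1 2;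
      g 2 0 ^ 2, g 2 1 ^ 2, g 2 2 ^ 2, 2 * g 2 0 * g 2 1, 2 * g 2 0 * g 2 2, 2 * g 2 1 * g 2 2;
      g 0 0 * g 1 0, g 0 1 * g 1 1, g 0 2 * g 1 2, g 0 0 * g 1 1 + g 0 1 * g 1 0,
        g 0 0 * g 1 2 + g 0 2 * g 1 0, g 0 1 * g 1 2 + g 0 2 * g 1 1;
      g 0 0 * g 2 0, g 0 1 * g 2 1, g 0 2 * g 2 2, g 0 0 * g 2 1 + g 0 1 * g 2 0,
        g 0 0 * g 2 2 + g 0 2 * g 2 0, g 0 1 * g 2 2 + g 0 2 * g 2 1;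
      g 1 0 * g 2 0, g 1 1 * g 2 1, g 1 2 * g 2 2, g 1 0 * g 2 1 + g 1 1 * g 2 0,
        g 1 0 * g 2 2 + g 1 2 * g 2 0, g 1 1 * g 2 2 + g 1 2 * g 2 1].det := by
  rw [← LinearMap.det_toMatrix
    (((Pi.basisFun ℝ (Fin 3)).prod (Pi.basisFun ℝ (Fin 3))).reindex finSumFinEquiv)]
  congr 1
  ext i j
  rw [LinearMap.toMatrix_apply]
  have e : ∀ k : Fin 6, finSumFinEquiv.symm k =
    (![Sum.inl 0, Sum.inl 1, Sum.inl 2, Sum.inr 0, Sum.inr 1, Sum.inr 2] :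
      Fin 6 → Fin 3 ⊕ Fin 3) k := by decide
  simp only [Module.Basis.reindex_apply, Module.Basis.repr_reindex_apply, e, sym3Congr_apply]
  fin_cases i <;> fin_cases j <;>
  simp [sym3Linear, sym3Coords, sym3, Matrix.mul_apply, Fin.sum_univ_three] <;> ring

set_option maxHeartbeats 1000000 in
lemma det_sym3Congr {g : Matrix (Fin 3) (Fin 3) ℝ} (hg : g.det ≠ 0) :
    LinearMap.det (sym3Congr g) = g.det ^ 4 := by
  refine Matrix.diagonal_transvection_induction_of_det_ne_zero
    (fun g => LinearMap.det (sym3Congr g) = g.det ^ 4) g hg ?_ ?_ ?_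
  · intro D _
    rw [det_sym3Congr_eq]
    simp [Matrix.det_succ_row_zero, Fin.sum_univ_succ, Fin.prod_univ_three, Fin.succAbove]
    ring
  · rintro ⟨i, j, hij, c⟩
    have hT : ∀ a b, (TransvectionStruct.mk i j hij c).toMatrix a b =
        (if a = b then 1 else 0) + if i = a ∧ j = b then c else 0 := fun a b => by
      simp [TransvectionStruct.toMatrix, transvection, Matrix.single, Matrix.one_apply]
    rw [det_sym3Congr_eq, TransvectionStruct.det]
    simp only [hT]
    fin_cases i <;> fin_cases j <;> first | exact absurd rfl hij | skip
    all_goals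
      simp
      simp [Matrix.det_succ_row_zero, Fin.sum_univ_succ, Fin.succAbove]
  · intro A B _ _ hA hB
    rw [sym3Congr_mul, LinearMap.det_comp, hA, hB, Matrix.det_mul, mul_pow]

lemma measurableSet_posDef_sym3 :
    MeasurableSet {p : (Fin 3 → ℝ) × (Fin 3 → ℝ) | (sym3 p.1 p.2).PosDef} := by
  have hc : Continuous fun p => sym3Linear p := LinearMap.continuous_of_finiteDimensional _
  have h : {p : (Fin 3 → ℝ) × (Fin 3 → ℝ) | (sym3 p.1 p.2).PosDef} =
      (⋂ v : Fin 3 → ℝ, {p | 0 ≤ v ⬝ᵥ (sym3Linear p *ᵥ v)}) ∩ {p | (sym3Linear p).det ≠ 0} := by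
    ext p
    simp only [Set.mem_inter_iff, Set.mem_iInter, Set.mem_ofPred_eq, ← sym3Linear_apply]
    constructor
    · exact fun hp => ⟨fun v => hp.posSemidef.dotProduct_mulVec_nonneg v, hp.det_pos.ne'⟩
    · rintro ⟨h₁, h₂⟩
      refine (PosSemidef.of_dotProduct_mulVec_nonneg (isSymm_sym3Linear p) h₁).posDef_iff_isUnit.2 ?_
      exact (isUnit_iff_isUnit_det _).2 h₂.isUnit
  rw [h]
  refine (IsClosed.measurableSet <| isClosed_iInter fun v => ?_).inter
    (IsOpen.measurableSet ?_)
  · exact isClosed_le continuous_const (by fun_prop)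
  · exact isOpen_ne_fun (by fun_prop) continuous_const

lemma abs_det_neg {E : Type*} [NormedAddCommGroup E] [NormedSpace ℝ E] (f : E →L[ℝ] E) :
    |(-f).det| = |f.det| := by
  have h : (-f).det = LinearMap.det ((-1 : ℝ) • (f : E →ₗ[ℝ] E)) := by
    rw [neg_one_smul]
    rfl
  rw [h, LinearMap.det_smul, abs_mul, abs_pow, abs_neg, abs_one, one_pow, one_mul]

section

attribute [local instance] Matrix.linftyOpNormedRing Matrix.linftyOpNormedAlgebra

/-- The map `y ↦ g y⁻¹ gᵀ` on symmetric matrices, in the coordinates of `sym3`. -/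
noncomputable def sym3CongrInv (g : Matrix (Fin 3) (Fin 3) ℝ) (p : (Fin 3 → ℝ) × (Fin 3 → ℝ)) :
    (Fin 3 → ℝ) × (Fin 3 → ℝ) :=
  sym3Coords (g * (sym3Linear p)⁻¹ * gᵀ)

lemma sym3Linear_sym3CongrInv (g : Matrix (Fin 3) (Fin 3) ℝ) (p : (Fin 3 → ℝ) × (Fin 3 → ℝ)) :
    sym3Linear (sym3CongrInv g p) = g * (sym3Linear p)⁻¹ * gᵀ := by
  refine sym3Linear_sym3Coords ?_
  simp [IsSymm, transpose_mul, transpose_nonsing_inv, (isSymm_sym3Linear _).eq, Matrix.mul_assoc]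

lemma hasFDerivAt_sym3CongrInv (g : Matrix (Fin 3) (Fin 3) ℝ) {p : (Fin 3 → ℝ) × (Fin 3 → ℝ)}
    (hp : (sym3Linear p).det ≠ 0) :
    HasFDerivAt (sym3CongrInv g)
      (-(sym3Congr (g * (sym3Linear p)⁻¹)).toContinuousLinearMap) p := by
  obtain ⟨u, hu⟩ := (isUnit_iff_isUnit_det _).2 hp.isUnit
  have h₁ := hasFDerivAt_ringInverse (𝕜 := ℝ) u
  rw [hu] at h₁
  have h₂ := h₁.comp p (LinearMap.toContinuousLinearMap sym3Linear).hasFDerivAt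
  have h₃ := (LinearMap.toContinuousLinearMap (sym3Coords ∘ₗ LinearMap.mulRight ℝ gᵀ ∘ₗ
    LinearMap.mulLeft ℝ g)).hasFDerivAt.comp p h₂
  refine (h₃.congr_fderiv ?_).congr_of_eventuallyEq (Filter.Eventually.of_forall fun q => ?_)
  · have hv : (↑u⁻¹ : Matrix (Fin 3) (Fin 3) ℝ) = (sym3Linear p)⁻¹ := by
      rw [coe_units_inv, hu]
    refine ContinuousLinearMap.ext fun q => ?_
    have ht : ((sym3Linear p)⁻¹)ᵀ = (sym3Linear p)⁻¹ := by
      rw [transpose_nonsing_inv, (isSymm_sym3Linear _).eq]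
    change sym3Coords (g * (-((u⁻¹).val * sym3Linear q * (u⁻¹).val)) * gᵀ) = -sym3Congr _ q
    simp [hv, sym3Congr_apply, transpose_mul, ht, Matrix.mul_assoc]
  · simp [sym3CongrInv, nonsing_inv_eq_ringInverse]

end

lemma exists_symm_mul_self_eq_inv {x : Matrix (Fin 3) (Fin 3) ℝ} (hx : x.PosDef) :
    ∃ g : Matrix (Fin 3) (Fin 3) ℝ, gᵀ = g ∧ g * x * g = 1 := by
  open scoped MatrixOrder in
  refine ⟨(CFC.sqrt x)⁻¹, ?_, ?_⟩
  · rw [transpose_nonsing_inv]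
    congr 1
    exact (CFC.sqrt_nonneg x).posSemidef.1
  · have h := CFC.sqrt_mul_sqrt_self x hx.posSemidef.nonneg
    have hd : IsUnit (CFC.sqrt x).det := by
      have := congrArg det h
      rw [det_mul] at this
      exact isUnit_of_mul_isUnit_left (this ▸ hx.det_pos.ne'.isUnit)
    nth_rw 2 [← h]
    rw [← Matrix.mul_assoc, nonsing_inv_mul _ hd, Matrix.one_mul, mul_nonsing_inv _ hd]

theorem K3_symmetry (ν : ℝ) (x : Matrix (Fin 3) (Fin 3) ℝ) (hx : x.PosDef) :
    K3 ν x = x.det ^ (-ν) * K3 (-ν) x := by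
  obtain ⟨g, hgt, hg⟩ := exists_symm_mul_self_eq_inv hx
  have hdet : g.det * x.det * g.det = 1 := by
    simpa using congrArg det hg
  have hgd : g.det ≠ 0 := by rintro h; simp [h] at hdet
  have hgu : IsUnit g.det := hgd.isUnit
  have hx' : x = g⁻¹ * g⁻¹ := by
    calc x = g⁻¹ * (g * x * g) * g⁻¹ := by
          rw [Matrix.mul_assoc g, nonsing_inv_mul_cancel_left _ _ hgu,
            mul_nonsing_inv_cancel_right _ _ hgu]
      _ = _ := by rw [hg, Matrix.mul_one]
  set s := {p : (Fin 3 → ℝ) × (Fin 3 → ℝ) | (sym3 p.1 p.2).PosDef} with hs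
  have hmaps : Set.MapsTo (sym3CongrInv g) s s := by
    intro p hp
    change (sym3Linear (sym3CongrInv g p)).PosDef
    rw [sym3Linear_sym3CongrInv]
    exact (IsUnit.posDef_star_right_conjugate_iff ((isUnit_iff_isUnit_det _).2 hgu)).2
      (PosDef.inv hp)
  have hinv : ∀ p ∈ s, sym3CongrInv g (sym3CongrInv g p) = p := by
    intro p hp
    have hpu : IsUnit (sym3Linear p).det := hp.det_pos.ne'.isUnit
    rw [sym3CongrInv, sym3Linear_sym3CongrInv, hgt, Matrix.mul_inv_rev, Matrix.mul_inv_rev,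
      nonsing_inv_nonsing_inv _ hpu, mul_nonsing_inv_cancel_left _ _ hgu,
      nonsing_inv_mul_cancel_right _ _ hgu, sym3Coords_sym3Linear]
  have himage : sym3CongrInv g '' s = s :=
    (Set.LeftInvOn.image_image hinv ▸ Set.image_mono hmaps.image_subset).antisymm' hmaps.image_subset
  have hinj : Set.InjOn (sym3CongrInv g) s := Set.LeftInvOn.injOn hinv
  have : (volume : Measure ((Fin 3 → ℝ) × (Fin 3 → ℝ))).IsAddHaarMeasure :=
    Measure.prod.instIsAddHaarMeasure (volume : Measure (Fin 3 → ℝ)) (volume : Measure (Fin 3 → ℝ))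
  have key := integral_image_eq_integral_abs_det_fderiv_smul volume measurableSet_posDef_sym3
    (fun p hp => (hasFDerivAt_sym3CongrInv g (PosDef.det_pos hp).ne').hasFDerivWithinAt) hinj
    (fun p => Real.exp (-(sym3 p.1 p.2)⁻¹.trace - (x * sym3 p.1 p.2).trace) *
        (sym3 p.1 p.2).det ^ (ν - 2))
  rw [himage] at key
  rw [K3, K3, key]
  rw [mul_left_comm, ← integral_const_mul (x.det ^ (-ν))]
  congr 1
  refine setIntegral_congr_fun measurableSet_posDef_sym3 fun p hp => ?_
  have hpd : 0 < (sym3Linear p).det := PosDef.det_pos hp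
  have hpu : IsUnit (sym3Linear p).det := hpd.ne'.isUnit
  have hgx : g.det ^ 2 = x.det⁻¹ := by
    refine eq_inv_of_mul_eq_one_left ?_
    rw [← hdet]
    ring
  have hjac : |(-(sym3Congr (g * (sym3Linear p)⁻¹)).toContinuousLinearMap).det| =
      x.det⁻¹ ^ 2 * (sym3Linear p).det⁻¹ ^ 4 := by
    have hd : (g * (sym3Linear p)⁻¹).det = g.det * (sym3Linear p).det⁻¹ := by
      rw [det_mul, det_nonsing_inv, Ring.inverse_eq_inv']
    rw [abs_det_neg, LinearMap.det_toContinuousLinearMap, det_sym3Congr (hd ▸ mul_ne_zero hgd (inv_ne_zero hpd.ne')), hd, ← hgx,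
      abs_of_nonneg (by positivity)]
    ring
  have htr₁ : (sym3Linear (sym3CongrInv g p))⁻¹.trace = (x * sym3Linear p).trace := by
    rw [sym3Linear_sym3CongrInv, hgt, Matrix.mul_inv_rev, Matrix.mul_inv_rev,
      nonsing_inv_nonsing_inv _ hpu, trace_mul_comm, Matrix.mul_assoc, ← hx', trace_mul_comm]
  have htr₂ : (x * sym3Linear (sym3CongrInv g p)).trace = (sym3Linear p)⁻¹.trace := by
    rw [sym3Linear_sym3CongrInv, hgt, trace_mul_comm, Matrix.mul_assoc, Matrix.mul_assoc,
      trace_mul_comm, Matrix.mul_assoc, hg, Matrix.mul_one]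
  have hdet' : (sym3Linear (sym3CongrInv g p)).det = x.det⁻¹ * (sym3Linear p).det⁻¹ := by
    rw [sym3Linear_sym3CongrInv, det_mul, det_mul, det_transpose, det_nonsing_inv,
      Ring.inverse_eq_inv', ← hgx]
    ring
  simp only [← sym3Linear_apply, hjac, htr₁, htr₂, hdet', smul_eq_mul]
  have hX := hx.det_pos
  rw [neg_sub_comm, mul_rpow (by positivity) (by positivity), inv_rpow hX.le, inv_rpow hpd.le,
    rpow_sub hX, rpow_sub hpd, sub_eq_add_neg (-ν), rpow_add hpd, rpow_neg hX.le, rpow_neg hpd.le,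
    rpow_neg hpd.le, rpow_two, rpow_two]
  field_simp
end

section
/- For every ν < −2, one has ∫_{H₃⁺} exp(−tr(y⁻¹)) (det y)^{ν−3} dy = (2π)³ Γ(−ν) Γ(−ν−1) Γ(−ν−2). -/
open MeasureTheory Real Matrix

open Set ENNReal
open Complex (normSq normSq_apply normSq_nonneg normSq_eq_norm_sq)

lemma lintegral_fin_three {α : Type*} [MeasureSpace α] [SigmaFinite (volume : Measure α)]
    {f : (Fin 3 → α) → ℝ≥0∞} (hf : Measurable f) :
    ∫⁻ a, f a = ∫⁻ x : α, ∫⁻ p : α × α, f ![x, p.1, p.2] := by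
  have h3 := (volume_preserving_piFinSuccAbove (fun _ : Fin 3 => α) 0).symm
  have h2 := (volume_preserving_finTwoArrow α).symm
  rw [← h3.lintegral_comp hf, Measure.volume_eq_prod, lintegral_prod _ (by fun_prop)]
  refine lintegral_congr fun x => ?_
  erw [← h2.lintegral_comp (by fun_prop)]
  refine lintegral_congr fun p => congrArg f ?_
  ext i
  fin_cases i <;> rfl

lemma Measurable.vec_three {γ δ : Type*} [MeasurableSpace γ] [MeasurableSpace δ] {g₀ g₁ g₂ : γ → δ}
    (h₀ : Measurable g₀) (h₁ : Measurable g₁) (h₂ : Measurable g₂) :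
    Measurable fun c => ![g₀ c, g₁ c, g₂ c] := by
  refine measurable_pi_iff.2 fun i => ?_
  fin_cases i <;> assumption

lemma lintegral_prod_fin_three {α β : Type*} [MeasureSpace α] [MeasureSpace β]
    [SigmaFinite (volume : Measure α)] [SigmaFinite (volume : Measure β)]
    {f : (Fin 3 → α) × (Fin 3 → β) → ℝ≥0∞} (hf : Measurable f) :
    ∫⁻ q, f q = ∫⁻ x : α, ∫⁻ u : β, ∫⁻ y : α, ∫⁻ p : β × β, ∫⁻ z : α,
      f (![x, y, z], ![u, p.1, p.2]) := by
  rw [Measure.volume_eq_prod, lintegral_prod _ (by fun_prop),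
    lintegral_fin_three hf.lintegral_prod_right']
  refine lintegral_congr fun x => ?_
  have hb (a : Fin 3 → α) : ∫⁻ b, f (a, b) = ∫⁻ u : β, ∫⁻ p : β × β, f (a, ![u, p.1, p.2]) :=
    lintegral_fin_three (by fun_prop)
  simp_rw [hb]
  have hx : Measurable fun c : (((α × α) × β) × (β × β)) =>
      f (![x, c.1.1.1, c.1.1.2], ![c.1.2, c.2.1, c.2.2]) := by
    refine hf.comp (.prodMk (.vec_three ?_ ?_ ?_) (.vec_three ?_ ?_ ?_)) <;> fun_prop
  rw [lintegral_lintegral_swap hx.lintegral_prod_right'.aemeasurable]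
  refine lintegral_congr fun u => ?_
  have hu : Measurable fun c : (α × α) × (β × β) => f (![x, c.1.1, c.1.2], ![u, c.2.1, c.2.2]) :=
    hx.comp (f := fun c : (α × α) × (β × β) => ((c.1, u), c.2)) (by fun_prop)
  rw [Measure.volume_eq_prod, lintegral_prod _ hu.lintegral_prod_right'.aemeasurable]
  refine lintegral_congr fun y => ?_
  have hy : Measurable (Function.uncurry fun (z : α) (p : β × β) =>
      f (![x, y, z], ![u, p.1, p.2])) :=
    hu.comp (f := fun c : α × (β × β) => ((y, c.1), c.2)) (by fun_prop)
  exact lintegral_lintegral_swap hy.aemeasurable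

lemma lintegral_ofReal_eq_of_integral_eq {α : Type*} [MeasurableSpace α] {μ : Measure α}
    {f : α → ℝ} {c : ℝ} (hf : 0 ≤ᵐ[μ] f) (hc : c ≠ 0) (h : ∫ x, f x ∂μ = c) :
    ∫⁻ x, ENNReal.ofReal (f x) ∂μ = ENNReal.ofReal c := by
  have hi : Integrable f μ := by
    by_contra hn
    exact hc (h ▸ integral_undef hn)
  rw [← h, ofReal_integral_eq_lintegral_ofReal hi hf]

lemma lintegral_exp_neg_mul_normSq_sub {k : ℝ} (hk : 0 < k) (w : ℂ) :
    ∫⁻ z : ℂ, ENNReal.ofReal (rexp (-(k * normSq (z - w)))) = ENNReal.ofReal (π / k) := by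
  rw [lintegral_sub_right_eq_self (fun z : ℂ => ENNReal.ofReal (rexp (-(k * normSq z)))) w]
  refine lintegral_ofReal_eq_of_integral_eq (.of_forall fun _ => (Real.exp_pos _).le)
    (by positivity) ?_
  have h := GaussianFourier.integral_rexp_neg_mul_sq_norm (V := ℂ) hk
  simpa [normSq_eq_norm_sq] using h

lemma lintegral_rpow_mul_exp_neg_inv {k : ℝ} (hk : k < -1) :
    ∫⁻ t in Ioi (0 : ℝ), ENNReal.ofReal (t ^ k * rexp (-(1 / t)))
      = ENNReal.ofReal (Real.Gamma (-k - 1)) := by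
  have hpos : 0 < -k - 1 := by linarith
  refine lintegral_ofReal_eq_of_integral_eq
    ((ae_restrict_mem measurableSet_Ioi).mono fun t (ht : 0 < t) => ?_)
    (Real.Gamma_pos_of_pos hpos).ne' ?_
  · exact mul_nonneg (Real.rpow_nonneg ht.le _) (Real.exp_pos _).le
  rw [Real.Gamma_eq_integral hpos, ← integral_comp_rpow_Ioi _ (show (-1 : ℝ) ≠ 0 by norm_num)]
  refine setIntegral_congr_fun measurableSet_Ioi fun t (ht : 0 < t) => ?_
  simp only [smul_eq_mul, abs_neg, abs_one, one_mul]
  rw [← Real.rpow_mul ht.le, mul_left_comm, mul_comm (rexp _), Real.rpow_neg_one, one_div,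
    inv_inv, mul_left_comm, ← mul_assoc, ← Real.rpow_add ht, mul_comm]
  ring_nf

noncomputable def herm2Det (x y : ℝ) (u : ℂ) : ℝ := x * y - normSq u

noncomputable def herm3Det (x y z : ℝ) (u v w : ℂ) : ℝ :=
  herm2Det x y u * z -
    (x * normSq w + y * normSq v - 2 * (u * w * (starRingEnd ℂ) v).re)

lemma det_herm3 (x y z : ℝ) (u v w : ℂ) :
    (herm3 ![x, y, z] ![u, v, w]).det = (herm3Det x y z u v w : ℂ) := by
  simp [herm3, herm3Det, herm2Det, det_fin_three]
  apply Complex.ext <;> simp [normSq_apply] <;> ring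

lemma trace_inv_herm3 (x y z : ℝ) (u v w : ℂ) :
    ((herm3 ![x, y, z] ![u, v, w])⁻¹.trace).re
      = (herm2Det y z w + herm2Det x z v + herm2Det x y u) / herm3Det x y z u v w := by
  rw [Matrix.inv_def, det_herm3, trace_smul, trace_fin_three, adjugate_fin_three]
  simp [herm3, herm2Det, Complex.mul_conj, div_eq_inv_mul]
  left
  rcases eq_or_ne (herm3Det x y z u v w) 0 with h | h <;> simp [h]

open scoped ComplexOrder in
lemma posDef_herm3_iff (x y z : ℝ) (u v w : ℂ) :
    (herm3 ![x, y, z] ![u, v, w]).PosDef ↔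
      0 < x ∧ 0 < herm2Det x y u ∧ 0 < herm3Det x y z u v w := by
  constructor
  · intro h
    refine ⟨?_, ?_, ?_⟩
    · simpa [herm3] using h.diag_pos (i := 0)
    · have h2 := (h.submatrix (e := ![0, 1]) (by decide)).det_pos
      rw [det_fin_two] at h2
      simp only [herm3, submatrix_apply, of_apply, cons_val_zero, cons_val_one, cons_val',
        cons_val_fin_one, Complex.mul_conj] at h2
      unfold herm2Det
      exact_mod_cast h2
    · simpa [det_herm3] using h.det_pos
  · rintro ⟨hx, h2, h3⟩
    set L : Matrix (Fin 3) (Fin 3) ℂ := !![1, 0, 0;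
      (starRingEnd ℂ) u / x, 1, 0;
      (starRingEnd ℂ) v / x, (x * (starRingEnd ℂ) w - (starRingEnd ℂ) v * u) / herm2Det x y u, 1]
      with hL
    have hLu : IsUnit L := by
      rw [isUnit_iff_isUnit_det]
      simp [hL, det_fin_three]
    have hM : herm3 ![x, y, z] ![u, v, w] = L * diagonal ![(x : ℂ), (herm2Det x y u / x : ℝ),
        (herm3Det x y z u v w / herm2Det x y u : ℝ)] * star L := by
      have hxc : (x : ℂ) ≠ 0 := by exact_mod_cast hx.ne'
      have h2c : (herm2Det x y u : ℂ) ≠ 0 := by exact_mod_cast h2.ne'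
      have e2 : (herm2Det x y u : ℂ) = x * y - u * (starRingEnd ℂ) u := by
        simp [herm2Det, Complex.mul_conj]
      have e3 : (herm3Det x y z u v w : ℂ) = herm2Det x y u * z -
          (x * (w * (starRingEnd ℂ) w) + y * (v * (starRingEnd ℂ) v) -
            (u * w * (starRingEnd ℂ) v + (starRingEnd ℂ) u * (starRingEnd ℂ) w * v)) := by
        apply Complex.ext <;> simp [herm3Det, normSq_apply] <;> ring
      ext i j
      fin_cases i <;> fin_cases j <;>
        simp [herm3, hL, mul_apply, Fin.sum_univ_three, vecMul_diagonal, e3] <;>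
        field_simp <;> first | ring1 | (rw [e2]; ring1)
    rw [hM, hLu.posDef_star_right_conjugate_iff, posDef_diagonal_iff]
    intro i
    fin_cases i
    · simpa using hx
    · simpa using! Complex.zero_lt_real.2 (div_pos h2 hx)
    · simpa using! Complex.zero_lt_real.2 (div_pos h3 h2)

lemma herm2Det_add_shift {x : ℝ} (hx : x ≠ 0) (s : ℝ) (u : ℂ) :
    herm2Det x (s + normSq u / x) u = x * s := by
  unfold herm2Det
  field_simp
  ring

lemma herm3Det_add_shift {x y : ℝ} {u : ℂ} (h : herm2Det x y u ≠ 0) (t : ℝ) (v w : ℂ) :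
    herm3Det x y (t + (x * normSq w + y * normSq v - 2 * (u * w * (starRingEnd ℂ) v).re) /
      herm2Det x y u) u v w = herm2Det x y u * t := by
  unfold herm3Det
  field_simp
  ring

noncomputable def herm2Weight (μ x y : ℝ) (u : ℂ) : ℝ≥0∞ :=
  if 0 < herm2Det x y u then
    ENNReal.ofReal (rexp (-((x + y) / herm2Det x y u)) * herm2Det x y u ^ μ) else 0

noncomputable def herm3Weight (μ x y z : ℝ) (u v w : ℂ) : ℝ≥0∞ :=
  if 0 < herm3Det x y z u v w then
    ENNReal.ofReal (rexp (-((herm2Det y z w + herm2Det x z v + herm2Det x y u) /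
      herm3Det x y z u v w)) * herm3Det x y z u v w ^ μ) else 0

lemma lintegral_herm2Weight_slice {μ x : ℝ} (hx : 0 < x) (u : ℂ) :
    ∫⁻ y, herm2Weight μ x y u = ∫⁻ s in Ioi (0 : ℝ),
      ENNReal.ofReal (x ^ μ * rexp (-(1 / x)) * (s ^ μ * rexp (-(1 / s)))) *
        ENNReal.ofReal (rexp (-((x ^ 2 * s)⁻¹ * normSq (u - 0)))) := by
  rw [← lintegral_add_right_eq_self _ (normSq u / x), ← lintegral_indicator measurableSet_Ioi]
  refine lintegral_congr fun s => ?_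
  rw [herm2Weight, herm2Det_add_shift hx.ne', Set.indicator_apply]
  by_cases hs : 0 < s
  · rw [if_pos (mul_pos hx hs), if_pos (mem_Ioi.2 hs), ← ENNReal.ofReal_mul (by positivity)]
    congr 1
    have e : -((x + (s + normSq u / x)) / (x * s)) =
        -(1 / x) + -(1 / s) + -((x ^ 2 * s)⁻¹ * normSq (u - 0)) := by
      rw [sub_zero]
      field_simp
      ring
    rw [e, Real.exp_add, Real.exp_add, Real.mul_rpow hx.le hs.le]
    ring
  · rw [if_neg (by rwa [mul_pos_iff_of_pos_left hx]), if_neg (notMem_Ioi.2 (not_lt.1 hs))]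

lemma lintegral_herm2Weight {μ x : ℝ} (hμ : μ < -2) (hx : 0 < x) :
    ∫⁻ u : ℂ, ∫⁻ y, herm2Weight μ x y u =
      ENNReal.ofReal (π * Real.Gamma (-μ - 2)) *
        ENNReal.ofReal (x ^ (μ + 2) * rexp (-(1 / x))) := by
  simp_rw [lintegral_herm2Weight_slice hx]
  rw [lintegral_lintegral_swap (by fun_prop)]
  have hΓ : 0 < Real.Gamma (-μ - 2) := Real.Gamma_pos_of_pos (by linarith)
  calc _ = ∫⁻ s in Ioi (0 : ℝ), ENNReal.ofReal (π * x ^ (μ + 2) * rexp (-(1 / x))) *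
        ENNReal.ofReal (s ^ (μ + 1) * rexp (-(1 / s))) := by
        refine setLIntegral_congr_fun measurableSet_Ioi fun s (hs : 0 < s) => ?_
        rw [lintegral_const_mul _ (by fun_prop),
          lintegral_exp_neg_mul_normSq_sub (by positivity), ← ENNReal.ofReal_mul (by positivity),
          ← ENNReal.ofReal_mul (by positivity), Real.rpow_add hx, Real.rpow_add hs]
        congr 1
        simp only [Real.rpow_ofNat, Real.rpow_one, div_inv_eq_mul]
        ring
    _ = _ := by
        rw [lintegral_const_mul _ (by fun_prop), lintegral_rpow_mul_exp_neg_inv (by linarith),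
          ← ENNReal.ofReal_mul (by positivity), ← ENNReal.ofReal_mul (by positivity)]
        ring_nf

lemma lintegral_exp_neg_normSq_inv_mul {x y t : ℝ} {u : ℂ} (hx : 0 < x)
    (hD : 0 < herm2Det x y u) (ht : 0 < t) :
    ∫⁻ p : ℂ × ℂ, ENNReal.ofReal (rexp (-((normSq (y * p.1 - u * p.2) +
      normSq (x * p.2 - (starRingEnd ℂ) u * p.1)) / (herm2Det x y u ^ 2 * t)))) =
      ENNReal.ofReal (π ^ 2 * t ^ 2 * herm2Det x y u ^ 2) := by
  have hβ : 0 < normSq u + x ^ 2 := by have := normSq_nonneg u; positivity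
  set β := normSq u + x ^ 2 with hβdef
  set c : ℂ := (starRingEnd ℂ) u * (x + y) / β with hc
  have key (v w : ℂ) : ENNReal.ofReal (rexp (-((normSq (y * v - u * w) +
      normSq (x * w - (starRingEnd ℂ) u * v)) / (herm2Det x y u ^ 2 * t)))) =
      ENNReal.ofReal (rexp (-((β * t)⁻¹ * normSq (v - 0)))) *
      ENNReal.ofReal (rexp (-(β / (herm2Det x y u ^ 2 * t) * normSq (w - c * v)))) := by
    rw [← ENNReal.ofReal_mul (by positivity), ← Real.exp_add]
    congr 2
    have hcre : c.re = u.re * (x + y) / β := by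
      rw [hc, Complex.div_ofReal_re]; simp
    have hcim : c.im = -(u.im * (x + y) / β) := by
      rw [hc, Complex.div_ofReal_im]; simp; ring
    have hsum : normSq (y * v - u * w) + normSq (x * w - (starRingEnd ℂ) u * v) =
        herm2Det x y u ^ 2 / β * normSq v + β * normSq (w - c * v) := by
      simp only [normSq_apply, Complex.sub_re, Complex.sub_im, Complex.mul_re, Complex.mul_im,
        hcre, hcim, herm2Det, Complex.ofReal_re, Complex.ofReal_im, Complex.conj_re,
        Complex.conj_im]
      field_simp
      rw [hβdef, normSq_apply]
      ring
    rw [hsum, sub_zero]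
    field_simp
    ring
  rw [Measure.volume_eq_prod, lintegral_prod _ (by fun_prop)]
  simp_rw [key]
  simp_rw [lintegral_const_mul' _ _ ENNReal.ofReal_ne_top]
  simp_rw [lintegral_exp_neg_mul_normSq_sub (k := β / (herm2Det x y u ^ 2 * t)) (by positivity)]
  rw [lintegral_mul_const _ (by fun_prop), lintegral_exp_neg_mul_normSq_sub (by positivity),
    ← ENNReal.ofReal_mul (by positivity)]
  congr 1
  field_simp

lemma lintegral_herm3Weight_slice {μ x y : ℝ} {u : ℂ} (hD : 0 < herm2Det x y u)
    (v w : ℂ) :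
    ∫⁻ z, herm3Weight μ x y z u v w = ∫⁻ t in Ioi (0 : ℝ),
      ENNReal.ofReal (herm2Det x y u ^ μ * rexp (-((x + y) / herm2Det x y u)) *
        (t ^ μ * rexp (-(1 / t)))) *
        ENNReal.ofReal (rexp (-((normSq (y * v - u * w) +
          normSq (x * w - (starRingEnd ℂ) u * v)) / (herm2Det x y u ^ 2 * t)))) := by
  rw [← lintegral_add_right_eq_self _ ((x * normSq w + y * normSq v -
    2 * (u * w * (starRingEnd ℂ) v).re) / herm2Det x y u), ← lintegral_indicator measurableSet_Ioi]
  refine lintegral_congr fun t => ?_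
  rw [herm3Weight, herm3Det_add_shift hD.ne', Set.indicator_apply]
  by_cases ht : 0 < t
  · rw [if_pos (mul_pos hD ht), if_pos (mem_Ioi.2 ht), ← ENNReal.ofReal_mul (by positivity)]
    congr 1
    set S := x * normSq w + y * normSq v - 2 * (u * w * (starRingEnd ℂ) v).re with hS
    have hq : normSq (y * v - u * w) + normSq (x * w - (starRingEnd ℂ) u * v) =
        (x + y) * S - herm2Det x y u * (normSq v + normSq w) := by
      simp only [hS, herm2Det, normSq_apply, Complex.sub_re, Complex.sub_im, Complex.mul_re,
        Complex.mul_im, Complex.ofReal_re, Complex.ofReal_im, Complex.conj_re, Complex.conj_im]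
      ring
    have h1 : herm2Det y (t + S / herm2Det x y u) w + herm2Det x (t + S / herm2Det x y u) v =
        (x + y) * (t + S / herm2Det x y u) - (normSq v + normSq w) := by
      unfold herm2Det
      ring
    have e : -((herm2Det y (t + S / herm2Det x y u) w + herm2Det x (t + S / herm2Det x y u) v +
        herm2Det x y u) / (herm2Det x y u * t)) =
        -((x + y) / herm2Det x y u) + -(1 / t) + -((normSq (y * v - u * w) +
          normSq (x * w - (starRingEnd ℂ) u * v)) / (herm2Det x y u ^ 2 * t)) := by
      rw [hq, h1]
      field_simp
      ring
    rw [e, Real.exp_add, Real.exp_add, Real.mul_rpow hD.le ht.le]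
    ring
  · rw [if_neg (by rwa [mul_pos_iff_of_pos_left hD]), if_neg (notMem_Ioi.2 (not_lt.1 ht))]

lemma lintegral_herm3Weight {μ x y : ℝ} {u : ℂ} (hμ : μ < -3) (hx : 0 < x)
    (hD : 0 < herm2Det x y u) :
    ∫⁻ p : ℂ × ℂ, ∫⁻ z, herm3Weight μ x y z u p.1 p.2 =
      ENNReal.ofReal (π ^ 2 * Real.Gamma (-μ - 3)) * herm2Weight (μ + 2) x y u := by
  simp_rw [lintegral_herm3Weight_slice hD]
  rw [lintegral_lintegral_swap (by fun_prop), herm2Weight, if_pos hD]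
  have hΓ : 0 < Real.Gamma (-μ - 3) := Real.Gamma_pos_of_pos (by linarith)
  calc _ = ∫⁻ t in Ioi (0 : ℝ), ENNReal.ofReal (π ^ 2 * herm2Det x y u ^ (μ + 2) *
          rexp (-((x + y) / herm2Det x y u))) *
        ENNReal.ofReal (t ^ (μ + 2) * rexp (-(1 / t))) := by
        refine setLIntegral_congr_fun measurableSet_Ioi fun t (ht : 0 < t) => ?_
        rw [lintegral_const_mul _ (by fun_prop), lintegral_exp_neg_normSq_inv_mul hx hD ht,
          ← ENNReal.ofReal_mul (by positivity), ← ENNReal.ofReal_mul (by positivity),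
          Real.rpow_add hD, Real.rpow_add ht]
        congr 1
        simp
        ring
    _ = _ := by
        rw [lintegral_const_mul _ (by fun_prop), lintegral_rpow_mul_exp_neg_inv (by linarith),
          ← ENNReal.ofReal_mul (by positivity), ← ENNReal.ofReal_mul (by positivity)]
        ring_nf

open scoped ComplexOrder in
theorem gammaConeHerm3 (ν : ℝ) (hν : ν < -2) :
    (2:ℝ) ^ 3 *
        ∫ p in {p : (Fin 3 → ℝ) × (Fin 3 → ℂ) | (herm3 p.1 p.2).PosDef},
          Real.exp (-((herm3 p.1 p.2)⁻¹.trace).re) * ((herm3 p.1 p.2).det.re) ^ (ν - 3)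
      = (2*π) ^ 3 * Gamma (-ν) * Gamma (-ν - 1) * Gamma (-ν - 2) := by
  have hS : {p : (Fin 3 → ℝ) × (Fin 3 → ℂ) | (herm3 p.1 p.2).PosDef} =
      {p | 0 < p.1 0 ∧ 0 < herm2Det (p.1 0) (p.1 1) (p.2 0) ∧
        0 < herm3Det (p.1 0) (p.1 1) (p.1 2) (p.2 0) (p.2 1) (p.2 2)} := by
    ext p
    rw [mem_ofPred_eq, mem_ofPred_eq, ← posDef_herm3_iff]
    rfl
  have hSm : MeasurableSet {p : (Fin 3 → ℝ) × (Fin 3 → ℂ) | (herm3 p.1 p.2).PosDef} := by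
    rw [hS]
    unfold herm3Det herm2Det
    rw [Set.ofPred_and, Set.ofPred_and]
    refine (measurableSet_lt ?_ ?_).inter ((measurableSet_lt ?_ ?_).inter (measurableSet_lt ?_ ?_))
      <;> fun_prop
  have hdet (p : (Fin 3 → ℝ) × (Fin 3 → ℂ)) : (herm3 p.1 p.2).det.re =
      herm3Det (p.1 0) (p.1 1) (p.1 2) (p.2 0) (p.2 1) (p.2 2) := by
    rw [← Complex.ofReal_re (herm3Det _ _ _ _ _ _), ← det_herm3]
    rfl
  have htr (p : (Fin 3 → ℝ) × (Fin 3 → ℂ)) : ((herm3 p.1 p.2)⁻¹.trace).re =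
      (herm2Det (p.1 1) (p.1 2) (p.2 2) + herm2Det (p.1 0) (p.1 2) (p.2 1) +
        herm2Det (p.1 0) (p.1 1) (p.2 0)) /
      herm3Det (p.1 0) (p.1 1) (p.1 2) (p.2 0) (p.2 1) (p.2 2) := by
    rw [← trace_inv_herm3]
    rfl
  have hm : Measurable fun p : (Fin 3 → ℝ) × (Fin 3 → ℂ) =>
      Real.exp (-((herm3 p.1 p.2)⁻¹.trace).re) * ((herm3 p.1 p.2).det.re) ^ (ν - 3) := by
    simp_rw [hdet, htr]
    unfold herm3Det herm2Det
    fun_prop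
  have h1 : 0 < Real.Gamma (-ν) := Real.Gamma_pos_of_pos (by linarith)
  have h2 : 0 < Real.Gamma (-ν - 1) := Real.Gamma_pos_of_pos (by linarith)
  have h3 : 0 < Real.Gamma (-ν - 2) := Real.Gamma_pos_of_pos (by linarith)
  rw [integral_eq_lintegral_of_nonneg_ae _ hm.aestronglyMeasurable]
  swap
  · refine (ae_restrict_mem hSm).mono fun p hp => ?_
    rw [hS] at hp
    simp only [hdet]
    exact mul_nonneg (Real.exp_pos _).le (Real.rpow_nonneg hp.2.2.le _)
  rw [← lintegral_indicator hSm, lintegral_prod_fin_three (hm.ennreal_ofReal.indicator hSm)]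
  have hw (x y z : ℝ) (u v w : ℂ) :
      {p : (Fin 3 → ℝ) × (Fin 3 → ℂ) | (herm3 p.1 p.2).PosDef}.indicator
        (fun p => ENNReal.ofReal (Real.exp (-((herm3 p.1 p.2)⁻¹.trace).re) *
          ((herm3 p.1 p.2).det.re) ^ (ν - 3))) (![x, y, z], ![u, v, w]) =
      if 0 < x ∧ 0 < herm2Det x y u then herm3Weight (ν - 3) x y z u v w else 0 := by
    classical
    simp only [Set.indicator_apply, mem_ofPred_eq, posDef_herm3_iff, det_herm3, trace_inv_herm3,
      Complex.ofReal_re, herm3Weight, ← and_assoc]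
    rw [ite_and]
  simp_rw [hw]
  have hp (x y : ℝ) (u : ℂ) : ∫⁻ p : ℂ × ℂ, ∫⁻ z, (if 0 < x ∧ 0 < herm2Det x y u then
      herm3Weight (ν - 3) x y z u p.1 p.2 else 0) =
      if 0 < x then ENNReal.ofReal (π ^ 2 * Real.Gamma (-ν)) * herm2Weight (ν - 1) x y u
        else 0 := by
    by_cases hx : 0 < x
    · by_cases hD : 0 < herm2Det x y u
      · simp only [hx, hD, and_self, if_true]
        rw [lintegral_herm3Weight (by linarith) hx hD]
        ring_nf
      · simp [hD, herm2Weight]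
    · simp [hx]
  simp_rw [hp]
  have hx (x : ℝ) : ∫⁻ u : ℂ, ∫⁻ y, (if 0 < x then
      ENNReal.ofReal (π ^ 2 * Real.Gamma (-ν)) * herm2Weight (ν - 1) x y u else 0) =
      (Ioi 0).indicator (fun x => ENNReal.ofReal (π ^ 3 * Real.Gamma (-ν) * Real.Gamma (-ν - 1)) *
        ENNReal.ofReal (x ^ (ν + 1) * rexp (-(1 / x)))) x := by
    rw [Set.indicator_apply]
    by_cases hx : 0 < x
    · simp only [hx, if_true, mem_Ioi]
      simp_rw [lintegral_const_mul' _ _ ENNReal.ofReal_ne_top]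
      rw [lintegral_herm2Weight (by linarith) hx, ← mul_assoc, ← ENNReal.ofReal_mul (by positivity)]
      ring_nf
    · simp [hx]
  simp_rw [hx]
  rw [lintegral_indicator measurableSet_Ioi, lintegral_const_mul _ (by fun_prop),
    lintegral_rpow_mul_exp_neg_inv (by linarith),
    show -(ν + 1) - 1 = -ν - 2 by ring, ← ENNReal.ofReal_mul (by positivity),
    ENNReal.toReal_ofReal (by positivity)]
  ring_nf
end

section
/- Let z be a positive definite real symmetric 2×2 matrix and let ν < 0. Then ∫₀^{∞} ∫_{ℝ²} exp( −1/t − ( tr(z)·⟨z⁻¹w, w⟩ − ‖w‖² ) / ( t · det z ) ) · t^{ν−2} dw dt = π Γ(−ν) det(z), where dw is the Lebesgue measure on ℝ², ⟨·,·⟩ is the standard inner product on ℝ², and ‖·‖ the Euclidean norm. -/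
open MeasureTheory Real Matrix

theorem integral_comp_mulVec {ι E : Type*} [Fintype ι] [DecidableEq ι] [NormedAddCommGroup E]
    [NormedSpace ℝ E] {M : Matrix ι ι ℝ} (hM : M.det ≠ 0) (f : (ι → ℝ) → E) :
    ∫ w, f (M *ᵥ w) = |M.det⁻¹| • ∫ u, f u := by
  have hdet : LinearMap.det (Matrix.toLin' M) ≠ 0 := by rwa [LinearMap.det_toLin']
  have hemb : MeasurableEmbedding (Matrix.toLin' M) :=
    ((Matrix.toLin' M).equivOfDetNeZero hdet).toContinuousLinearEquiv.toHomeomorph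
      |>.measurableEmbedding
  have hmap := hemb.integral_map (μ := volume) f
  rw [Real.map_matrix_volume_pi_eq_smul_volume_pi hM, integral_smul_measure,
    ENNReal.toReal_ofReal (abs_nonneg _)] at hmap
  simpa [Matrix.toLin'_apply] using hmap.symm

theorem integral_exp_neg_dotProduct_self_div {ι : Type*} [Fintype ι] (t : ℝ) :
    ∫ u : ι → ℝ, Real.exp (-(u ⬝ᵥ u) / t) = √(π * t) ^ Fintype.card ι := by
  have hprod (u : ι → ℝ) : Real.exp (-(u ⬝ᵥ u) / t) = ∏ i, Real.exp (-t⁻¹ * u i ^ 2) := by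
    rw [← Real.exp_sum, ← Finset.mul_sum]
    congr 1
    simp only [dotProduct, ← sq]
    ring
  simp_rw [hprod]
  rw [integral_fintype_prod_volume_eq_pow (fun x : ℝ ↦ Real.exp (-t⁻¹ * x ^ 2)),
    integral_gaussian, div_inv_eq_mul]

/-- The Cayley–Hamilton identity for a symmetric `2 × 2` matrix, as an identity of quadratic
forms. -/
theorem Matrix.IsSymm.trace_mul_dotProduct_mulVec_sub {R : Type*} [CommRing R]
    {z : Matrix (Fin 2) (Fin 2) R} (hz : z.IsSymm) (u : Fin 2 → R) :
    z.trace * (u ⬝ᵥ z *ᵥ u) - z *ᵥ u ⬝ᵥ z *ᵥ u = z.det * (u ⬝ᵥ u) := by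
  have h := hz.apply 0 1
  simp only [dotProduct, mulVec, Matrix.trace_fin_two, Matrix.det_fin_two, Fin.sum_univ_two, h]
  ring

theorem integral_exp_neg_inv_mul_rpow {s : ℝ} (hs : s < 0) :
    ∫ t in Set.Ioi (0 : ℝ), Real.exp (-1 / t) * t ^ (s - 1) = Gamma (-s) := by
  rw [Real.Gamma_eq_integral (neg_pos.mpr hs),
    ← integral_comp_rpow_Ioi _ (by norm_num : (-1 : ℝ) ≠ 0)]
  refine setIntegral_congr_fun measurableSet_Ioi fun t (ht : 0 < t) ↦ ?_
  have hpow : t ^ (-s - 1) = t ^ (-1 - 1 : ℝ) * (t ^ (-1 : ℝ)) ^ (s - 1) := by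
    rw [← Real.rpow_mul ht.le, ← Real.rpow_add ht]
    ring_nf
  simp only [hpow, abs_neg, abs_one, one_mul, smul_eq_mul, Real.rpow_neg_one, neg_div, one_div, inv_inv]
  ring

theorem gaussian_time_integral (ν : ℝ) (hν : ν < 0)
    (z : Matrix (Fin 2) (Fin 2) ℝ) (hz : z.PosDef) :
    (∫ t in Set.Ioi (0:ℝ), ∫ w : Fin 2 → ℝ,
        Real.exp (-1/t - (z.trace * (z⁻¹.mulVec w ⬝ᵥ w) - w ⬝ᵥ w) / (t * z.det)) *
          t ^ (ν - 2))
      = π * Gamma (-ν) * z.det := by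
  have hdet := hz.det_pos
  have hunit : IsUnit z.det := hdet.ne'.isUnit
  have hsymm : z.IsSymm := by simpa [Matrix.IsHermitian, Matrix.IsSymm] using hz.isHermitian
  have hquad (w : Fin 2 → ℝ) :
      z.trace * (z⁻¹ *ᵥ w ⬝ᵥ w) - w ⬝ᵥ w = z.det * (z⁻¹ *ᵥ w ⬝ᵥ z⁻¹ *ᵥ w) := by
    simpa only [Matrix.mulVec_mulVec, Matrix.mul_nonsing_inv z hunit, Matrix.one_mulVec] using
      hsymm.trace_mul_dotProduct_mulVec_sub (z⁻¹ *ᵥ w)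
  have hinner (t : ℝ) (ht : 0 < t) :
      ∫ w : Fin 2 → ℝ, Real.exp (-1/t - (z.trace * (z⁻¹.mulVec w ⬝ᵥ w) - w ⬝ᵥ w) / (t * z.det)) *
          t ^ (ν - 2) = π * z.det * (Real.exp (-1 / t) * t ^ (ν - 1)) := by
    have hexp (w : Fin 2 → ℝ) :
        Real.exp (-1/t - (z.trace * (z⁻¹.mulVec w ⬝ᵥ w) - w ⬝ᵥ w) / (t * z.det)) =
          Real.exp (-1 / t) * Real.exp (-(z⁻¹ *ᵥ w ⬝ᵥ z⁻¹ *ᵥ w) / t) := by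
      rw [hquad, ← Real.exp_add]
      congr 1
      field_simp
      ring
    have hpow : t ^ (ν - 1) = t * t ^ (ν - 2) := by
      rw [← Real.rpow_one_add' ht.le (by linarith)]
      ring_nf
    simp_rw [hexp]
    rw [integral_mul_const, integral_const_mul,
      integral_comp_mulVec (Matrix.isUnit_nonsing_inv_det z hunit).ne_zero
        (fun u ↦ Real.exp (-(u ⬝ᵥ u) / t)),
      integral_exp_neg_dotProduct_self_div, Fintype.card_fin, Real.sq_sqrt (by positivity),
      Matrix.det_nonsing_inv, Ring.inverse_eq_inv', inv_inv, abs_of_pos hdet, hpow, smul_eq_mul]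
    ring
  rw [setIntegral_congr_fun measurableSet_Ioi hinner, integral_const_mul,
    integral_exp_neg_inv_mul_rpow hν]
  ring
end

section
/- Let d > 0 and ν ∈ ℝ be such that ν is not a positive integer, ν is not a negative integer, and ν + d/2 is not a positive integer. Then for all t₁ ∈ ℝ and t₂ > 0 one has J_ν^{[3,3]}(t₁, t₂, 0) = t₂^{−ν−d/2} · J_{−ν−d/2}^{[2,1]}(t₁, t₂). -/
open MeasureTheory Real Matrix

theorem poch_zero (a : ℝ) : poch a 0 = 1 := by
  simp [poch]

theorem poch_one_ne_zero (k : ℕ) : poch 1 k ≠ 0 :=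
  Finset.prod_ne_zero_iff.2 fun i _ => by positivity

theorem J33_reduction (d ν : ℝ) (hd : 0 < d)
    (h1 : ∀ n : ℤ, 0 < n → ν ≠ n)
    (h2 : ∀ n : ℤ, n < 0 → ν ≠ n)
    (h3 : ∀ n : ℤ, 0 < n → ν + d/2 ≠ n)
    (t₁ t₂ : ℝ) (ht₂ : 0 < t₂) :
    J33 d ν t₁ t₂ 0 = t₂ ^ (-ν - d/2) * J21 d (-ν - d/2) t₁ t₂ := by
  have hinj : Function.Injective fun p : ℕ × ℕ => (p.1, p.2, 0) := by
    rintro ⟨a, b⟩ ⟨a', b'⟩ h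
    simpa using h
  unfold J33 J21
  rw [← tsum_mul_left, ← hinj.tsum_eq]
  · refine tsum_congr fun p => ?_
    have hpow : t₂ ^ ((p.2 : ℝ) - ν - d/2) = t₂ ^ (-ν - d/2) * t₂ ^ p.2 := by
      rw [← rpow_add_natCast ht₂.ne']
      congr 1
      ring
    have harg₁ : 1 + (-ν - d/2) = 1 - ν - d/2 := by ring
    have harg₂ : 1 - ν - d/2 + d/2 = 1 - ν := by ring
    simp only [mul_zero, add_zero, pow_zero, poch_zero, mul_one, hpow, harg₁, harg₂]
    rw [← mul_div_assoc]
    refine Eq.trans ?_ (mul_div_mul_right _ _ (poch_one_ne_zero (p.1 + 2 * p.2)))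
    congr 1 <;> ring
  · rintro ⟨a, b, c⟩ hm
    obtain rfl : c = 0 := by
      by_contra hc
      simp [hc] at hm
    exact ⟨(a, b), rfl⟩
end

section
/- Let d > 0 and ν ∈ ℝ be such that neither ν nor ν + d/2 is a negative integer. Then the function g(t₁,t₂) = J_ν^{[2,1]}(t₁,t₂) is smooth on ℝ² and satisfies, at every point (t₁,t₂) ∈ ℝ², the two equations: t₁·∂²g/∂t₁² + 2t₂·∂²g/∂t₁∂t₂ + (ν+1+d/2)·∂g/∂t₁ + g = 0, and t₂·∂²g/∂t₂² − ∂²g/∂t₁² + (ν+1)·∂g/∂t₂ = 0. -/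
open MeasureTheory Real Matrix

/-- A double sequence is the coefficient family of an everywhere absolutely convergent
power series in two variables. -/
def IsEntireCoeff (c : ℕ → ℕ → ℝ) : Prop :=
  ∀ R : ℝ, 1 ≤ R → Summable fun m : ℕ × ℕ => |c m.1 m.2| * R ^ (m.1 + m.2)

/-- The sum of the double power series with coefficients `c`. -/
noncomputable def doubleSeries (c : ℕ → ℕ → ℝ) (p : ℝ × ℝ) : ℝ :=
  ∑' m : ℕ × ℕ, c m.1 m.2 * p.1 ^ m.1 * p.2 ^ m.2

/-- Coefficients of the partial derivative in the first variable. -/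
def coeffDerivFst (c : ℕ → ℕ → ℝ) (a b : ℕ) : ℝ := (a + 1) * c (a + 1) b

/-- Coefficients of the partial derivative in the second variable. -/
def coeffDerivSnd (c : ℕ → ℕ → ℝ) (a b : ℕ) : ℝ := (b + 1) * c a (b + 1)

theorem coeffDeriv_comm (c : ℕ → ℕ → ℝ) :
    coeffDerivFst (coeffDerivSnd c) = coeffDerivSnd (coeffDerivFst c) := by
  funext a b
  simp only [coeffDerivFst, coeffDerivSnd]
  ring

theorem injective_succ_fst : Function.Injective fun m : ℕ × ℕ => (m.1 + 1, m.2) := by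
  rintro ⟨a, b⟩ ⟨a', b'⟩ h
  simpa using h

theorem injective_succ_snd : Function.Injective fun m : ℕ × ℕ => (m.1, m.2 + 1) := by
  rintro ⟨a, b⟩ ⟨a', b'⟩ h
  simpa using h

namespace IsEntireCoeff

variable {c : ℕ → ℕ → ℝ}

theorem derivFst (hc : IsEntireCoeff c) : IsEntireCoeff (coeffDerivFst c) := by
  intro R hR
  refine Summable.of_nonneg_of_le (fun m => by positivity) (fun m => ?_)
    ((hc (2 * R) (by linarith)).comp_injective injective_succ_fst)
  obtain ⟨a, b⟩ := m
  simp only [coeffDerivFst, Function.comp_apply]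
  have h₁ : ((a : ℝ) + 1) ≤ 2 ^ (a + 1 + b) := by
    have h₂ : a + 1 < 2 ^ (a + 1) := Nat.lt_two_pow_self
    have h₃ : 2 ^ (a + 1) ≤ 2 ^ (a + 1 + b) := Nat.pow_le_pow_right (by norm_num) (by omega)
    exact_mod_cast h₂.le.trans h₃
  have h₄ : R ^ (a + b) ≤ R ^ (a + 1 + b) := pow_le_pow_right₀ hR (by omega)
  rw [abs_mul, abs_of_nonneg (by positivity : (0 : ℝ) ≤ a + 1), mul_pow]
  calc ((a : ℝ) + 1) * |c (a + 1) b| * R ^ (a + b)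
      = |c (a + 1) b| * (((a : ℝ) + 1) * R ^ (a + b)) := by ring
    _ ≤ _ := by gcongr

theorem derivSnd (hc : IsEntireCoeff c) : IsEntireCoeff (coeffDerivSnd c) := by
  intro R hR
  refine Summable.of_nonneg_of_le (fun m => by positivity) (fun m => ?_)
    ((hc (2 * R) (by linarith)).comp_injective injective_succ_snd)
  obtain ⟨a, b⟩ := m
  simp only [coeffDerivSnd, Function.comp_apply]
  have h₁ : ((b : ℝ) + 1) ≤ 2 ^ (a + (b + 1)) := by
    have h₂ : b + 1 < 2 ^ (b + 1) := Nat.lt_two_pow_self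
    have h₃ : 2 ^ (b + 1) ≤ 2 ^ (a + (b + 1)) := Nat.pow_le_pow_right (by norm_num) (by omega)
    exact_mod_cast h₂.le.trans h₃
  have h₄ : R ^ (a + b) ≤ R ^ (a + (b + 1)) := pow_le_pow_right₀ hR (by omega)
  rw [abs_mul, abs_of_nonneg (by positivity : (0 : ℝ) ≤ b + 1), mul_pow]
  calc ((b : ℝ) + 1) * |c a (b + 1)| * R ^ (a + b)
      = |c a (b + 1)| * (((b : ℝ) + 1) * R ^ (a + b)) := by ring
    _ ≤ _ := by gcongr

theorem summable (hc : IsEntireCoeff c) (p : ℝ × ℝ) :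
    Summable fun m : ℕ × ℕ => c m.1 m.2 * p.1 ^ m.1 * p.2 ^ m.2 := by
  refine Summable.of_norm_bounded (hc (1 + ‖p‖) (by simp)) fun m => ?_
  have h₁ : |p.1| ≤ 1 + ‖p‖ := (norm_fst_le p).trans (by simp)
  have h₂ : |p.2| ≤ 1 + ‖p‖ := (norm_snd_le p).trans (by simp)
  rw [Real.norm_eq_abs, abs_mul, abs_mul, abs_pow, abs_pow, pow_add, ← mul_assoc]
  gcongr

theorem hasSum (hc : IsEntireCoeff c) (p : ℝ × ℝ) :
    HasSum (fun m : ℕ × ℕ => c m.1 m.2 * p.1 ^ m.1 * p.2 ^ m.2) (doubleSeries c p) :=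
  (hc.summable p).hasSum

theorem hasSum_derivFst (hc : IsEntireCoeff c) (p : ℝ × ℝ) :
    HasSum (fun m : ℕ × ℕ => c m.1 m.2 * (m.1 * p.1 ^ (m.1 - 1)) * p.2 ^ m.2)
      (doubleSeries (coeffDerivFst c) p) := by
  rw [← injective_succ_fst.hasSum_iff]
  · convert hc.derivFst.hasSum p using 2 with m
    simp only [Function.comp_apply, coeffDerivFst, Nat.add_sub_cancel]
    push_cast
    ring
  · rintro ⟨a, b⟩ h
    cases a with
    | zero => simp
    | succ a => exact absurd ⟨(a, b), rfl⟩ h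

theorem hasSum_derivSnd (hc : IsEntireCoeff c) (p : ℝ × ℝ) :
    HasSum (fun m : ℕ × ℕ => c m.1 m.2 * p.1 ^ m.1 * (m.2 * p.2 ^ (m.2 - 1)))
      (doubleSeries (coeffDerivSnd c) p) := by
  rw [← injective_succ_snd.hasSum_iff]
  · convert hc.derivSnd.hasSum p using 2 with m
    simp only [Function.comp_apply, coeffDerivSnd, Nat.add_sub_cancel]
    push_cast
    ring
  · rintro ⟨a, b⟩ h
    cases b with
    | zero => simp
    | succ b => exact absurd ⟨(a, b), rfl⟩ h

theorem hasSum_eulerFst (hc : IsEntireCoeff c) (p : ℝ × ℝ) :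
    HasSum (fun m : ℕ × ℕ => m.1 * c m.1 m.2 * p.1 ^ m.1 * p.2 ^ m.2)
      (p.1 * doubleSeries (coeffDerivFst c) p) := by
  refine ((hc.hasSum_derivFst p).mul_left p.1).congr_fun fun m => ?_
  obtain ⟨_ | a, b⟩ := m
  · simp
  · simp only [Nat.add_sub_cancel]
    ring

theorem hasSum_eulerSnd (hc : IsEntireCoeff c) (p : ℝ × ℝ) :
    HasSum (fun m : ℕ × ℕ => m.2 * c m.1 m.2 * p.1 ^ m.1 * p.2 ^ m.2)
      (p.2 * doubleSeries (coeffDerivSnd c) p) := by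
  refine ((hc.hasSum_derivSnd p).mul_left p.2).congr_fun fun m => ?_
  obtain ⟨a, _ | b⟩ := m
  · simp
  · simp only [Nat.add_sub_cancel]
    ring

theorem hasFDerivAt (hc : IsEntireCoeff c) (p : ℝ × ℝ) :
    HasFDerivAt (doubleSeries c)
      (doubleSeries (coeffDerivFst c) p • ContinuousLinearMap.fst ℝ ℝ ℝ +
        doubleSeries (coeffDerivSnd c) p • ContinuousLinearMap.snd ℝ ℝ ℝ) p := by
  set R : ℝ := 1 + ‖p‖ with hRdef
  have hR : 1 ≤ R := by simp [hRdef]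
  have hp : p ∈ Metric.ball (0 : ℝ × ℝ) R := by simp [hRdef]
  have hmono : ∀ n : ℕ, R ^ (n - 1) ≤ R ^ n := fun n => pow_le_pow_right₀ hR (by omega)
  have key := hasFDerivAt_tsum_of_isPreconnected (𝕜 := ℝ)
    (f := fun (m : ℕ × ℕ) (q : ℝ × ℝ) => c m.1 m.2 * q.1 ^ m.1 * q.2 ^ m.2)
    (f' := fun (m : ℕ × ℕ) (q : ℝ × ℝ) =>
      (c m.1 m.2 * (m.1 * q.1 ^ (m.1 - 1)) * q.2 ^ m.2) • ContinuousLinearMap.fst ℝ ℝ ℝ +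
      (c m.1 m.2 * q.1 ^ m.1 * (m.2 * q.2 ^ (m.2 - 1))) • ContinuousLinearMap.snd ℝ ℝ ℝ)
    (hc (2 * R) (by linarith)) Metric.isOpen_ball
    (convex_ball (0 : ℝ × ℝ) R).isPreconnected ?_ ?_ hp (hc.summable p) hp
  · refine key.congr_fderiv ?_
    exact (((hc.hasSum_derivFst p).smul_const (ContinuousLinearMap.fst ℝ ℝ ℝ)).add
      ((hc.hasSum_derivSnd p).smul_const (ContinuousLinearMap.snd ℝ ℝ ℝ))).tsum_eq
  · rintro ⟨a, b⟩ q -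
    have h₁ := ((hasFDerivAt_fst (𝕜 := ℝ) (p := q)).pow a).const_mul (c a b)
    have h₂ := (hasFDerivAt_snd (𝕜 := ℝ) (p := q)).pow b
    refine (h₁.mul h₂).congr_fderiv ?_
    ext <;> simp <;> ring
  · rintro ⟨a, b⟩ q hq
    have hq' : ‖q‖ ≤ R := by simpa using (Metric.mem_ball.1 hq).le
    have h₁ : |q.1| ≤ R := (norm_fst_le q).trans hq'
    have h₂ : |q.2| ≤ R := (norm_snd_le q).trans hq'
    have hab : (a : ℝ) + b ≤ 2 ^ (a + b) := by
      exact_mod_cast (Nat.lt_two_pow_self (n := a + b)).le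
    refine (norm_add_le _ _).trans ?_
    rw [norm_smul, norm_smul]
    calc _ ≤ ‖c a b * (a * q.1 ^ (a - 1)) * q.2 ^ b‖ * 1 +
          ‖c a b * q.1 ^ a * (b * q.2 ^ (b - 1))‖ * 1 := by
          gcongr
          · exact ContinuousLinearMap.norm_fst_le ..
          · exact ContinuousLinearMap.norm_snd_le ..
      _ = |c a b| * (a * |q.1| ^ (a - 1)) * |q.2| ^ b +
          |c a b| * |q.1| ^ a * (b * |q.2| ^ (b - 1)) := by
          simp
      _ ≤ |c a b| * (a * R ^ (a - 1)) * R ^ b + |c a b| * R ^ a * (b * R ^ (b - 1)) := by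
          gcongr
      _ ≤ |c a b| * (a * R ^ a) * R ^ b + |c a b| * R ^ a * (b * R ^ b) := by
          gcongr |c a b| * (a * ?_) * _ + _ * (b * ?_) <;> exact hmono _
      _ = |c a b| * (((a : ℝ) + b) * R ^ (a + b)) := by rw [pow_add]; ring
      _ ≤ |c a b| * (2 * R) ^ (a + b) := by
          rw [mul_pow]
          gcongr

theorem contDiff_nat (n : ℕ) :
    ∀ {c : ℕ → ℕ → ℝ}, IsEntireCoeff c → ContDiff ℝ n (doubleSeries c) := by
  induction n with
  | zero =>
    intro c hc
    exact contDiff_zero.2 (continuous_iff_continuousAt.2 fun p => (hc.hasFDerivAt p).continuousAt)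
  | succ n ih =>
    intro c hc
    refine contDiff_succ_iff_hasFDerivAt.2 ⟨_, ?_, hc.hasFDerivAt⟩
    exact ((ih hc.derivFst).smul contDiff_const).add ((ih hc.derivSnd).smul contDiff_const)

theorem contDiff (hc : IsEntireCoeff c) : ContDiff ℝ (⊤ : ℕ∞) (doubleSeries c) :=
  contDiff_infty.2 fun n => contDiff_nat n hc

theorem deriv_fst (hc : IsEntireCoeff c) (x y : ℝ) :
    deriv (fun s => doubleSeries c (s, y)) x = doubleSeries (coeffDerivFst c) (x, y) := by
  have h := (hc.hasFDerivAt (x, y)).comp_hasDerivAt x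
    ((hasDerivAt_id x).prodMk (hasDerivAt_const x y))
  simpa [Function.comp_def] using h.deriv

theorem deriv_snd (hc : IsEntireCoeff c) (x y : ℝ) :
    deriv (fun s => doubleSeries c (x, s)) y = doubleSeries (coeffDerivSnd c) (x, y) := by
  have h := (hc.hasFDerivAt (x, y)).comp_hasDerivAt y
    ((hasDerivAt_const y x).prodMk (hasDerivAt_id y))
  simpa [Function.comp_def] using h.deriv

end IsEntireCoeff

theorem poch_succ (α : ℝ) (k : ℕ) : poch α (k + 1) = poch α k * (α + k) :=
  Finset.prod_range_succ _ _

theorem poch_one (k : ℕ) : poch 1 k = k.factorial := by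
  induction k with
  | zero => simp [poch]
  | succ k ih =>
    rw [poch_succ, ih, Nat.factorial_succ]
    push_cast
    ring

theorem exists_abs_inv_poch_le (α : ℝ) :
    ∃ B : ℝ, 1 ≤ B ∧ ∀ k : ℕ, |(poch α k)⁻¹| ≤ B ^ k := by
  have ht : Filter.Tendsto (fun n : ℕ => |(α + n)⁻¹|) Filter.atTop (nhds |0|) :=
    (tendsto_inv_atTop_zero.comp
      (Filter.tendsto_atTop_add_const_left _ α tendsto_natCast_atTop_atTop)).abs
  obtain ⟨B, hB⟩ := ht.bddAbove_range
  refine ⟨max 1 B, le_max_left _ _, fun k => ?_⟩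
  rw [poch, ← Finset.prod_inv_distrib, Finset.abs_prod]
  refine (Finset.prod_le_prod (g := fun _ => max 1 B) (fun i _ => abs_nonneg _)
    fun i _ => ?_).trans (by simp)
  exact (hB ⟨i, rfl⟩).trans (le_max_right _ _)

/-- The coefficients of the series `J21`. -/
noncomputable def coeffJ21 (d ν : ℝ) (a b : ℕ) : ℝ :=
  (-1) ^ a / (poch 1 a * poch 1 b * poch (1 + ν) b * poch (1 + ν + d/2) (a + 2*b))

theorem isEntireCoeff_coeffJ21 (d ν : ℝ) : IsEntireCoeff (coeffJ21 d ν) := by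
  intro R hR
  obtain ⟨B, hB, hBk⟩ := exists_abs_inv_poch_le (1 + ν)
  obtain ⟨C, hC, hCk⟩ := exists_abs_inv_poch_le (1 + ν + d/2)
  have hs := (Real.summable_pow_div_factorial (C * R)).mul_of_nonneg
    (Real.summable_pow_div_factorial (B * C ^ 2 * R)) (fun _ => by positivity)
    (fun _ => by positivity)
  refine Summable.of_nonneg_of_le (fun m => by positivity) (fun m => ?_) hs
  obtain ⟨a, b⟩ := m
  simp only [coeffJ21, poch_one]
  calc _ = (a.factorial : ℝ)⁻¹ * (b.factorial : ℝ)⁻¹ * |(poch (1 + ν) b)⁻¹| *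
        |(poch (1 + ν + d/2) (a + 2*b))⁻¹| * R ^ (a + b) := by
        rw [abs_div, abs_pow]
        simp only [abs_neg, abs_one, one_pow, abs_mul, abs_inv, Nat.abs_cast, one_div, mul_inv]
    _ ≤ (a.factorial : ℝ)⁻¹ * (b.factorial : ℝ)⁻¹ * B ^ b * C ^ (a + 2*b) * R ^ (a + b) := by
        gcongr
        · exact hBk b
        · exact hCk _
    _ = _ := by
        simp only [mul_pow, pow_add, pow_mul]
        ring

theorem J21_eq_doubleSeries (d ν x y : ℝ) : J21 d ν x y = doubleSeries (coeffJ21 d ν) (x, y) := by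
  refine tsum_congr fun m => ?_
  simp only [coeffJ21]
  ring

theorem coeffJ21_succ_fst {d ν : ℝ} (h : ∀ n : ℕ, 1 + ν + d/2 + n ≠ 0) (a b : ℕ) :
    (a + 1) * (a + 2 * b + (ν + 1 + d/2)) * coeffJ21 d ν (a + 1) b = -coeffJ21 d ν a b := by
  have h₁ := h (a + 2 * b)
  push_cast at h₁
  have ha : (1 : ℝ) + a ≠ 0 := by positivity
  have key : poch 1 (a + 1) * poch (1 + ν + d/2) (a + 1 + 2*b) =
      ((1 + a) * (1 + ν + d/2 + (a + 2*b))) *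
        (poch 1 a * poch (1 + ν + d/2) (a + 2*b)) := by
    rw [show a + 1 + 2*b = a + 2*b + 1 by ring, poch_succ, poch_succ]
    push_cast
    ring
  have hne := mul_ne_zero ha h₁
  calc _ = (1 + a) * (1 + ν + d/2 + (a + 2*b)) * (-((-1) ^ a /
        ((poch 1 b * poch (1 + ν) b) *
          (poch 1 (a + 1) * poch (1 + ν + d/2) (a + 1 + 2*b))))) := by
        simp only [coeffJ21, pow_succ]
        ring
    _ = _ := by
        rw [key, coeffJ21]
        generalize (1 + (a : ℝ)) * (1 + ν + d/2 + (a + 2*b)) = e at hne ⊢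
        field_simp

theorem coeffJ21_succ_snd {d ν : ℝ} (h : ∀ n : ℕ, 1 + ν + n ≠ 0) (a b : ℕ) :
    (b + 1) * (b + (ν + 1)) * coeffJ21 d ν a (b + 1) =
      (a + 1) * (a + 2) * coeffJ21 d ν (a + 2) b := by
  have h₁ := h b
  have hb : (1 : ℝ) + b ≠ 0 := by positivity
  have ha : (1 : ℝ) + a ≠ 0 := by positivity
  have ha' : (1 : ℝ) + (a + 1) ≠ 0 := by positivity
  simp only [coeffJ21, show a + 2 * (b + 1) = a + 2 + 2 * b by ring, poch_succ, pow_succ]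
  push_cast
  rw [show ((b : ℝ) + 1) * (b + (ν + 1)) = (1 + b) * (1 + ν + b) by ring,
    show ((a : ℝ) + 1) * (a + 2) = (1 + a) * (1 + (a + 1)) by ring]
  simp only [div_eq_mul_inv, mul_inv]
  field_simp

theorem J21_solves_muirhead (d ν : ℝ) (hd : 0 < d)
    (h1 : ∀ n : ℤ, n < 0 → ν ≠ n)
    (h2 : ∀ n : ℤ, n < 0 → ν + d/2 ≠ n) :
    ContDiff ℝ (⊤ : ℕ∞) (fun p : ℝ × ℝ => J21 d ν p.1 p.2) ∧
    ∀ t₁ t₂ : ℝ,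
      (t₁ * deriv (fun s => deriv (fun u => J21 d ν u t₂) s) t₁
        + 2 * t₂ * deriv (fun s => deriv (fun u => J21 d ν s u) t₂) t₁
        + (ν + 1 + d/2) * deriv (fun s => J21 d ν s t₂) t₁
        + J21 d ν t₁ t₂ = 0) ∧
      (t₂ * deriv (fun u => deriv (fun u' => J21 d ν t₁ u') u) t₂
        - deriv (fun s => deriv (fun u => J21 d ν u t₂) s) t₁
        + (ν + 1) * deriv (fun u => J21 d ν t₁ u) t₂ = 0) := by
  have hν : ∀ n : ℕ, 1 + ν + n ≠ 0 := fun n hn =>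
    h1 (-(n + 1)) (by omega) (by push_cast; linarith)
  have hνd : ∀ n : ℕ, 1 + ν + d/2 + n ≠ 0 := fun n hn =>
    h2 (-(n + 1)) (by omega) (by push_cast; linarith)
  have hc := isEntireCoeff_coeffJ21 d ν
  simp only [J21_eq_doubleSeries, hc.deriv_fst, hc.deriv_snd, hc.derivFst.deriv_fst,
    hc.derivSnd.deriv_fst, hc.derivSnd.deriv_snd, coeffDeriv_comm]
  refine ⟨hc.contDiff, fun t₁ t₂ => ⟨?_, ?_⟩⟩
  · have hsum := (((hc.derivFst.hasSum_eulerFst (t₁, t₂)).add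
      ((hc.derivFst.hasSum_eulerSnd (t₁, t₂)).mul_left 2)).add
      ((hc.derivFst.hasSum (t₁, t₂)).mul_left (ν + 1 + d/2))).add (hc.hasSum (t₁, t₂))
    rw [mul_assoc 2 t₂]
    refine hsum.unique (hasSum_zero.congr_fun fun m => ?_)
    simp only [coeffDerivFst]
    linear_combination t₁ ^ m.1 * t₂ ^ m.2 * coeffJ21_succ_fst hνd m.1 m.2
  · have hsum := ((hc.derivSnd.hasSum_eulerSnd (t₁, t₂)).sub
      (hc.derivFst.derivFst.hasSum (t₁, t₂))).add
      ((hc.derivSnd.hasSum (t₁, t₂)).mul_left (ν + 1))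
    refine hsum.unique (hasSum_zero.congr_fun fun m => ?_)
    simp only [coeffDerivFst, coeffDerivSnd]
    push_cast
    linear_combination t₁ ^ m.1 * t₂ ^ m.2 * coeffJ21_succ_snd (d := d) hν m.1 m.2
end
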